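/- arXiv:2410.14884 — 3 statements merged into one kernel-verified Lean document; each statement's English description precedes it below -/
import Mathlib

section
/- Let G be a group and let a, b ∈ G satisfy a*b*a = b*a*b, and set Δ = a*b*a. Then for every ζ ∈ G, writing γ = a⁻¹ * ζ * a⁻¹, the following identity holds: Δ⁻² * a * (Δ * ζ * Δ⁻¹) * a² * ζ⁻¹ * a = b⁻¹ * γ * b⁻¹ * γ⁻¹. -/
/-- Let `G` be a group, `a, b ∈ G` with `a*b*a = b*a*b`, and `Δ = a*b*a`.
Then for every `ζ ∈ G`, writing `γ = a⁻¹ * ζ * a⁻¹`, one has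
`Δ⁻² * a * (Δ * ζ * Δ⁻¹) * a² * ζ⁻¹ * a = b⁻¹ * γ * b⁻¹ * γ⁻¹`. -/
theorem braided_su_identity {G : Type*} [Group G] (a b : G)
    (h : a * b * a = b * a * b) (Δ : G) (hΔ : Δ = a * b * a)
    (ζ γ : G) (hγ : γ = a⁻¹ * ζ * a⁻¹) :
    (Δ ^ 2)⁻¹ * a * (Δ * ζ * Δ⁻¹) * a ^ 2 * ζ⁻¹ * a = b⁻¹ * γ * b⁻¹ * γ⁻¹ := by
  have hconj : a * Δ = Δ * b := by
    rw [hΔ]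
    nth_rewrite 1 [h]
    group
  have hleft : (Δ ^ 2)⁻¹ * a * Δ = b⁻¹ * a⁻¹ := by
    rw [mul_assoc, hconj, hΔ, h, pow_two, mul_inv_rev]
    group
  have hright : Δ⁻¹ * a ^ 2 = a⁻¹ * b⁻¹ * a := by
    rw [hΔ]
    group
  calc (Δ ^ 2)⁻¹ * a * (Δ * ζ * Δ⁻¹) * a ^ 2 * ζ⁻¹ * a
      = ((Δ ^ 2)⁻¹ * a * Δ) * ζ * (Δ⁻¹ * a ^ 2) * ζ⁻¹ * a := by simp only [mul_assoc]
    _ = b⁻¹ * γ * b⁻¹ * γ⁻¹ := by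
      rw [hleft, hright, hγ]
      group
end

section
/- In B₃, let φ be the automorphism determined by φ(σ₁) = σ₂ and φ(σ₂) = σ₁, and for ζ ∈ B₃ write ζ̄ = φ(ζ). Then for every ζ ∈ B₃, setting γ = σ₁⁻¹ * ζ * σ₁⁻¹, the element β′ = Δ⁻² * σ₁ * ζ̄ * σ₁² * ζ⁻¹ * σ₁ satisfies β′ = σ₂⁻¹ * γ * σ₂⁻¹ * γ⁻¹, and hence β′ is conjugate in B₃ to γ * σ₂⁻¹ * γ⁻¹ * σ₂⁻¹. -/
/-- The single braid relation `σ₁σ₂σ₁ = σ₂σ₁σ₂` on two generators, as a relator set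
in the free group on `Fin 2`. -/
def braidRel : Set (FreeGroup (Fin 2)) :=
  {FreeGroup.of 0 * FreeGroup.of 1 * FreeGroup.of 0 *
    (FreeGroup.of 1 * FreeGroup.of 0 * FreeGroup.of 1)⁻¹}

/-- The braid group `B₃` on three strands, presented on two generators `σ₁, σ₂`
subject to `σ₁σ₂σ₁ = σ₂σ₁σ₂`. -/
abbrev B₃ : Type := PresentedGroup braidRel

/-- The standard generator `σ₁` of `B₃`. -/
def σ₁ : B₃ := PresentedGroup.of 0

/-- The standard generator `σ₂` of `B₃`. -/
def σ₂ : B₃ := PresentedGroup.of 1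

/-- The Garside element `Δ = σ₁σ₂σ₁` of `B₃`. -/
def Δ : B₃ := σ₁ * σ₂ * σ₁

theorem braid_relation : σ₁ * σ₂ * σ₁ = σ₂ * σ₁ * σ₂ :=
  mul_inv_eq_one.mp (PresentedGroup.one_of_mem (rels := braidRel) rfl)

theorem Δ_mul_σ₁ : Δ * σ₁ = σ₂ * Δ := by
  rw [Δ, braid_relation, mul_assoc, mul_assoc, mul_assoc, ← mul_assoc σ₁ σ₂ σ₁, braid_relation,
    mul_assoc]

theorem Δ_mul_σ₂ : Δ * σ₂ = σ₁ * Δ := by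
  rw [Δ, mul_assoc, mul_assoc, ← mul_assoc σ₂ σ₁ σ₂, ← braid_relation]

/-- An automorphism exchanging the two generators is conjugation by `Δ`. -/
theorem swap_eq_conj_Δ (φ : B₃ ≃* B₃) (hφ₁ : φ σ₁ = σ₂) (hφ₂ : φ σ₂ = σ₁) (ζ : B₃) :
    φ ζ = Δ * ζ * Δ⁻¹ := by
  have h : φ.toMonoidHom = (MulAut.conj Δ).toMonoidHom := by
    refine PresentedGroup.ext fun i => ?_
    fin_cases i
    · exact hφ₁.trans (eq_mul_inv_of_mul_eq Δ_mul_σ₁.symm)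
    · exact hφ₂.trans (eq_mul_inv_of_mul_eq Δ_mul_σ₂.symm)
  exact DFunLike.congr_fun h ζ

/-- Let `φ` be the automorphism of `B₃` determined by `φ(σ₁) = σ₂`, `φ(σ₂) = σ₁`,
and write `ζ̄ = φ(ζ)`. For every `ζ ∈ B₃`, setting `γ = σ₁⁻¹ * ζ * σ₁⁻¹`, the braid
`β′ = Δ⁻² σ₁ ζ̄ σ₁² ζ⁻¹ σ₁` satisfies `β′ = σ₂⁻¹ γ σ₂⁻¹ γ⁻¹`, and hence `β′` is
conjugate in `B₃` to the symmetric union braid `γ σ₂⁻¹ γ⁻¹ σ₂⁻¹`. -/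
theorem family_one_braids_are_su_braids
    (φ : B₃ ≃* B₃) (hφ₁ : φ σ₁ = σ₂) (hφ₂ : φ σ₂ = σ₁)
    (ζ γ β' : B₃) (hγ : γ = σ₁⁻¹ * ζ * σ₁⁻¹)
    (hβ' : β' = (Δ ^ 2)⁻¹ * σ₁ * φ ζ * σ₁ ^ 2 * ζ⁻¹ * σ₁) :
    β' = σ₂⁻¹ * γ * σ₂⁻¹ * γ⁻¹ ∧ IsConj β' (γ * σ₂⁻¹ * γ⁻¹ * σ₂⁻¹) := by
  have h₁ : (Δ ^ 2)⁻¹ * σ₁ * Δ = σ₂⁻¹ * σ₁⁻¹ := by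
    rw [mul_assoc, ← Δ_mul_σ₂, sq, mul_inv_rev, mul_assoc, inv_mul_cancel_left, Δ, braid_relation]
    group
  have h₂ : Δ⁻¹ * σ₁ ^ 2 = σ₁⁻¹ * σ₂⁻¹ * σ₁ := by
    rw [Δ]
    group
  have key : β' = σ₂⁻¹ * γ * σ₂⁻¹ * γ⁻¹ := by
    calc β' = ((Δ ^ 2)⁻¹ * σ₁ * Δ) * ζ * (Δ⁻¹ * σ₁ ^ 2) * ζ⁻¹ * σ₁ := by
          rw [hβ', swap_eq_conj_Δ φ hφ₁ hφ₂]
          simp only [mul_assoc]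
      _ = σ₂⁻¹ * γ * σ₂⁻¹ * γ⁻¹ := by
          rw [h₁, h₂, hγ]
          group
  refine ⟨key, isConj_iff.mpr ⟨σ₂, ?_⟩⟩
  rw [key]
  group
end

section
/- The linear dual operation is an involution: for every nonempty list b of integers all of whose entries are ≥ 2, the linear dual of the linear dual of b equals b. Equivalently, the relation 'c is the linear dual of b' on such strings is symmetric. -/
/-- The linear dual of a string of natural numbers (intended domain: nonempty
lists with all entries `≥ 2`).  It is characterized by the explicit description:
the dual of `(2^[m])` is `(m+1)`, and the dual of
`(2^[m₁], 3+n₁, 2^[m₂], 3+n₂, …, 2^[m_l], 2+n_l)` (all `mᵢ, nᵢ ≥ 0`) is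
`(2+m₁, 2^[n₁], 3+m₂, 2^[n₂], 3+m₃, …, 3+m_l, 2^[n_l])`,
where `2^[m]` denotes the entry `2` repeated `m` times.  This description is
implemented by the left-to-right recursion below: prepending a `2` to the string
increments the first entry of the dual (the dual of `(2+n)` alone being
`(2, 2^[n])`), while incrementing the first entry of a string of length `≥ 2`
prepends a `2` to the dual. -/
def linearDualNat : List ℕ → List ℕ
  | [] => []
  | [n] => 2 :: List.replicate (n - 2) 2
  | 0 :: _ => []
  | 1 :: _ => []
  | 2 :: rest =>
      match linearDualNat rest with
      | [] => []
      | c :: cs => (c + 1) :: cs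
  | (n + 3) :: rest => 2 :: linearDualNat ((n + 2) :: rest)
termination_by l => l.sum
decreasing_by all_goals (simp [List.sum_cons]; try omega)

/-- The linear dual of a string of integers (intended domain: nonempty lists with
all entries `≥ 2`), computed via the natural-number version. -/
def linearDual (b : List ℤ) : List ℤ :=
  (linearDualNat (b.map Int.toNat)).map (fun n => (n : ℤ))

theorem linearDual_eq_map_natCast (b : List ℤ) :
    linearDual b = (linearDualNat (b.map Int.toNat)).map Nat.cast := by
  simp [linearDual, List.map_eq_flatMap]

theorem linearDualNat_two_cons {r c : List ℕ} {a : ℕ} (hr : r ≠ [])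
    (h : linearDualNat r = a :: c) : linearDualNat (2 :: r) = (a + 1) :: c := by
  cases r with
  | nil => exact absurd rfl hr
  | cons x xs => rw [linearDualNat, h]; simp

theorem linearDualNat_add_three_cons (n : ℕ) (r : List ℕ) :
    linearDualNat ((n + 3) :: r) = 2 :: linearDualNat ((n + 2) :: r) := by
  cases r with
  | nil => simp [linearDualNat, List.replicate_succ]
  | cons x xs => rw [linearDualNat]; simp

/-- On a nonempty string with entries at least `2`, the dual is again such a string and
dualizing twice gives back the original. -/
theorem linearDualNat_spec (l : List ℕ) (hne : l ≠ []) (hl : ∀ x ∈ l, 2 ≤ x) :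
    linearDualNat l ≠ [] ∧ (∀ x ∈ linearDualNat l, 2 ≤ x) ∧
      linearDualNat (linearDualNat l) = l := by
  cases l with
  | nil => exact absurd rfl hne
  | cons a r =>
    have hr : ∀ x ∈ r, 2 ≤ x := fun x hx => hl x (List.mem_cons_of_mem _ hx)
    obtain ⟨n, rfl⟩ := Nat.exists_eq_add_of_le' (hl a List.mem_cons_self)
    clear hl hne
    induction n with
    | zero =>
      by_cases hr0 : r = []
      · subst hr0
        simp [linearDualNat]
      · obtain ⟨h1, h2, h3⟩ := linearDualNat_spec r hr0 hr
        obtain ⟨c, cs, hc⟩ := List.exists_cons_of_ne_nil h1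
        rw [hc] at h2 h3
        obtain ⟨k, rfl⟩ := Nat.exists_eq_add_of_le' (h2 c List.mem_cons_self)
        rw [Nat.zero_add, linearDualNat_two_cons hr0 hc]
        refine ⟨by simp, ?_, ?_⟩
        · simp only [List.mem_cons, forall_eq_or_imp] at h2 ⊢
          exact ⟨by omega, h2.2⟩
        · rw [linearDualNat_add_three_cons, h3]
    | succ n ih =>
      obtain ⟨h1, h2, h3⟩ := ih
      rw [show n + 1 + 2 = n + 3 from rfl, linearDualNat_add_three_cons]
      refine ⟨by simp, ?_, linearDualNat_two_cons h1 h3⟩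
      simpa using h2
termination_by l.length

/-- The linear dual operation is an involution: for every nonempty list `b` of
integers all of whose entries are `≥ 2`, the linear dual of the linear dual of `b`
equals `b`.  Equivalently, the relation `c` is the linear dual of `b` is symmetric. -/
theorem linearDual_linearDual (b : List ℤ) (hne : b ≠ []) (hb : ∀ x ∈ b, 2 ≤ x) :
    linearDual (linearDual b) = b := by
  obtain ⟨-, -, h⟩ := linearDualNat_spec (b.map Int.toNat) (by simpa using hne) (by
    intro x hx
    obtain ⟨y, hy, rfl⟩ := List.mem_map.1 hx
    have := hb y hy
    omega)
  have hcast : ∀ l : List ℕ, (l.map (Nat.cast : ℕ → ℤ)).map Int.toNat = l := by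
    intro l
    simp [Function.comp_def]
  rw [linearDual_eq_map_natCast, linearDual_eq_map_natCast, hcast, h, List.map_map]
  conv_rhs => rw [← List.map_id b]
  refine List.map_congr_left fun x hx => ?_
  exact Int.toNat_of_nonneg (by have := hb x hx; omega)
end
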